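/- Let K be an algebraically closed field of characteristic 0, let n ≥ 2, k ≥ 1, l ≥ 0. Let t : ℕ → ℕ be given by t(i) = i+1 for 0 ≤ i ≤ n−1, t(j) = 2 for n ≤ j ≤ n+k, t(j) = 1 for n+k+1 ≤ j ≤ n+k+1+l, and t(j) = 0 for j > n+k+1+l. Then there exist finitely many homogeneous ideals J_1, …, J_m of K[x,y] such that every homogeneous ideal I of K[x,y] with t_I = t satisfies φ(I) = J_i for some linear change of variables φ and some i. -/

import Mathlib

open MvPolynomial

noncomputable section

/-- The polynomial ring `K[x,y]`. -/
abbrev Pxy (K : Type*) [Field K] := MvPolynomial (Fin 2) K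

/-- An ideal of `K[x,y]` is homogeneous if it contains all homogeneous
components of each of its elements. -/
def IsHomog {K : Type*} [Field K] (I : Ideal (Pxy K)) : Prop :=
  ∀ f ∈ I, ∀ k : ℕ, homogeneousComponent k f ∈ I

/-- The Hilbert function of an ideal:
`t_I(k) = dim_K (K[x,y]_k / (I ∩ K[x,y]_k))`. -/
def hilb (K : Type*) [Field K] (I : Ideal (Pxy K)) (k : ℕ) : ℕ :=
  Module.finrank K
    (homogeneousSubmodule (Fin 2) K k ⧸
      Submodule.comap (homogeneousSubmodule (Fin 2) K k).subtype (I.restrictScalars K))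

/-- A linear change of variables: a `K`-algebra automorphism sending the
variables to homogeneous polynomials of degree 1. -/
def IsLinChange {K : Type*} [Field K] (φ : Pxy K ≃ₐ[K] Pxy K) : Prop :=
  ∀ i : Fin 2, (φ (X i)).IsHomogeneous 1

/-- `t` is of homogeneous finite type: there are finitely many homogeneous ideals
`J₁, …, Jₘ` such that every homogeneous ideal `I` with Hilbert function `t` is
mapped onto some `Jᵢ` by a linear change of variables. -/
def HomogFiniteType (K : Type*) [Field K] (t : ℕ → ℕ) : Prop :=
  ∃ S : Set (Ideal (Pxy K)), S.Finite ∧ (∀ J ∈ S, IsHomog J) ∧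
    ∀ I : Ideal (Pxy K), IsHomog I → (∀ k, hilb K I k = t k) →
      ∃ φ : Pxy K ≃ₐ[K] Pxy K, IsLinChange φ ∧ Ideal.map φ I ∈ S

theorem finrank_homogeneousSubmodule (K : Type*) [Field K] (m : ℕ) :
    Module.finrank K (homogeneousSubmodule (Fin 2) K m) = m + 1 := by
  rw [homogeneousSubmodule_eq_finsupp_supported]
  change Module.finrank K (restrictSupport K {d : Fin 2 →₀ ℕ | d.degree = m}) = m + 1
  rw [Module.finrank_eq_nat_card_basis (basisRestrictSupport K {d : Fin 2 →₀ ℕ | d.degree = m})]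
  have e : {d : Fin 2 →₀ ℕ | d.degree = m} ≃ Finset.HasAntidiagonal.antidiagonal m :=
    { toFun := fun d => ⟨(d.1 0, d.1 1), by
        have := d.2
        simpa [Finsupp.degree_eq_sum, Fin.sum_univ_two] using this⟩
      invFun := fun p => ⟨Finsupp.equivFunOnFinite.symm ![p.1.1, p.1.2], by
        have := Finset.HasAntidiagonal.mem_antidiagonal.1 p.2
        simpa [Finsupp.degree_eq_sum, Fin.sum_univ_two] using this⟩
      left_inv := by
        rintro ⟨d, hd⟩
        ext i
        fin_cases i <;> rfl
      right_inv := by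
        rintro ⟨⟨a, b⟩, h⟩
        rfl }
  rw [Nat.card_congr e, Nat.card_eq_fintype_card, Fintype.card_coe, Finset.Nat.card_antidiagonal]

instance finiteDimensional_homogeneousSubmodule (K : Type*) [Field K] (m : ℕ) :
    FiniteDimensional K (homogeneousSubmodule (Fin 2) K m) :=
  Module.finite_of_finrank_pos (by rw [finrank_homogeneousSubmodule]; omega)

section

variable {K : Type*} [Field K]

theorem isHomogeneous_of_mul_left {f h : Pxy K} {a b : ℕ} (hf : f.IsHomogeneous a)
    (hf0 : f ≠ 0) (hfh : (f * h).IsHomogeneous (a + b)) : h.IsHomogeneous b := by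
  let _ := gradedAlgebra (σ := Fin 2) (R := K)
  have key : homogeneousComponent (a + b) (f * h) = f * homogeneousComponent b h := by
    rw [← decomposition.decompose'_apply, ← decomposition.decompose'_apply]
    exact DirectSum.coe_decompose_mul_add_of_left_mem (homogeneousSubmodule (Fin 2) K)
      (j := b) (b := h) ((mem_homogeneousSubmodule a f).2 hf)
  rw [homogeneousComponent_eq_self hfh] at key
  rw [mul_left_cancel₀ hf0 key]
  exact homogeneousComponent_isHomogeneous _ _

/-- The degree `j` part of an ideal. -/
def degreePart (J : Ideal (Pxy K)) (j : ℕ) : Submodule K (Pxy K) :=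
  J.restrictScalars K ⊓ homogeneousSubmodule (Fin 2) K j

theorem mem_degreePart {J : Ideal (Pxy K)} {j : ℕ} {p : Pxy K} :
    p ∈ degreePart J j ↔ p ∈ J ∧ p.IsHomogeneous j := Iff.rfl

instance finiteDimensional_degreePart (J : Ideal (Pxy K)) (j : ℕ) :
    FiniteDimensional K (degreePart J j) :=
  Submodule.finiteDimensional_of_le inf_le_right

theorem hilb_add_finrank_degreePart (J : Ideal (Pxy K)) (j : ℕ) :
    hilb K J j + Module.finrank K (degreePart J j) = j + 1 := by
  have h := Submodule.finrank_quotient_add_finrank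
    (Submodule.comap (homogeneousSubmodule (Fin 2) K j).subtype (J.restrictScalars K))
  rw [finrank_homogeneousSubmodule] at h
  rw [← h, hilb, degreePart, inf_comm, ← Submodule.map_comap_subtype,
    Submodule.finrank_map_subtype_eq]

/-- The space of products of `f` with forms of degree `m`. -/
def mulForms (f : Pxy K) (m : ℕ) : Submodule K (Pxy K) :=
  (homogeneousSubmodule (Fin 2) K m).map (LinearMap.mulLeft K f)

theorem mul_mem_mulForms (f : Pxy K) {q : Pxy K} {m : ℕ} (hq : q.IsHomogeneous m) :
    f * q ∈ mulForms f m := ⟨q, hq, rfl⟩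

instance finiteDimensional_mulForms (f : Pxy K) (m : ℕ) : FiniteDimensional K (mulForms f m) :=
  inferInstanceAs (FiniteDimensional K
    ((homogeneousSubmodule (Fin 2) K m).map (LinearMap.mulLeft K f) : Submodule K (Pxy K)))

theorem finrank_map_mulLeft {f : Pxy K} (hf : f ≠ 0) (V : Submodule K (Pxy K)) :
    Module.finrank K (V.map (LinearMap.mulLeft K f)) = Module.finrank K V :=
  (LinearEquiv.finrank_eq (Submodule.equivMapOfInjective _
    (fun _ _ h => mul_left_cancel₀ hf h) V)).symm

theorem finrank_mulForms {f : Pxy K} (hf : f ≠ 0) (m : ℕ) :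
    Module.finrank K (mulForms f m) = m + 1 := by
  rw [mulForms, finrank_map_mulLeft hf, finrank_homogeneousSubmodule]

theorem exists_sub_smul_mem {E : Type*} [AddCommGroup E] [Module K E] {V W : Submodule K E}
    [FiniteDimensional K W] (hVW : V ≤ W)
    (hd : Module.finrank K W ≤ Module.finrank K V + 1) {h : E} (hW : h ∈ W) (hV : h ∉ V)
    {p : E} (hp : p ∈ W) : ∃ c : K, p - c • h ∈ V := by
  have hle : V ⊔ Submodule.span K {h} ≤ W :=
    sup_le hVW ((Submodule.span_singleton_le_iff_mem _ _).2 hW)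
  have : FiniteDimensional K V := Submodule.finiteDimensional_of_le hVW
  have : FiniteDimensional K ↥(V ⊔ Submodule.span K {h}) := Submodule.finiteDimensional_of_le hle
  have hlt : V < V ⊔ Submodule.span K {h} := by
    refine lt_of_le_of_ne le_sup_left fun heq => hV ?_
    rw [heq]
    exact Submodule.mem_sup_right (Submodule.mem_span_singleton_self h)
  have := Submodule.finrank_lt_finrank_of_lt hlt
  rw [← Submodule.eq_of_le_of_finrank_le hle (by omega)] at hp
  obtain ⟨v, hv, w, hw, rfl⟩ := Submodule.mem_sup.1 hp
  obtain ⟨c, rfl⟩ := Submodule.mem_span_singleton.1 hw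
  exact ⟨c, by simpa using hv⟩

theorem exists_eq_X_mul_add {i j : Fin 2} (hij : i ≠ j) {m : ℕ} {p : Pxy K}
    (hp : p.IsHomogeneous (m + 1)) :
    ∃ (q : Pxy K) (c : K), q.IsHomogeneous m ∧ p = X i * q + C c * X j ^ (m + 1) := by
  have hle : mulForms (X i : Pxy K) m ≤ homogeneousSubmodule (Fin 2) K (m + 1) := by
    rintro _ ⟨q, hq, rfl⟩
    exact add_comm 1 m ▸ (isHomogeneous_X K i).mul hq
  obtain ⟨c, q, hq, h⟩ := exists_sub_smul_mem (h := X j ^ (m + 1)) (p := p) hle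
    (by rw [finrank_mulForms (X_ne_zero i), finrank_homogeneousSubmodule])
    (isHomogeneous_X_pow j _) (by
      rintro ⟨q, -, h⟩
      have hd : (X i : Pxy K) ∣ X j := (X_prime (R := K)).dvd_of_dvd_pow ⟨q, h.symm⟩
      exact hij (X_dvd_X.1 hd)) hp
  refine ⟨q, c, hq, ?_⟩
  rw [LinearMap.mulLeft_apply] at h
  rw [h, smul_eq_C_mul]
  ring

theorem exists_eq_X_zero_sq_mul_add {m : ℕ} {p : Pxy K} (hp : p.IsHomogeneous (m + 2)) :
    ∃ (q : Pxy K) (c d : K), q.IsHomogeneous m ∧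
      p = X 0 ^ 2 * q + C c * (X 0 * X 1 ^ (m + 1)) + C d * X 1 ^ (m + 2) := by
  obtain ⟨q, d, hq, rfl⟩ := exists_eq_X_mul_add (zero_ne_one : (0 : Fin 2) ≠ 1) hp
  obtain ⟨r, c, hr, rfl⟩ := exists_eq_X_mul_add (zero_ne_one : (0 : Fin 2) ≠ 1) hq
  exact ⟨r, c, d, hr, by ring⟩

theorem exists_eq_X_zero_mul_X_one_mul_add {m : ℕ} {p : Pxy K} (hp : p.IsHomogeneous (m + 2)) :
    ∃ (q : Pxy K) (c d : K), q.IsHomogeneous m ∧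
      p = X 0 * X 1 * q + C c * X 0 ^ (m + 2) + C d * X 1 ^ (m + 2) := by
  obtain ⟨q, d, hq, rfl⟩ := exists_eq_X_mul_add (zero_ne_one : (0 : Fin 2) ≠ 1) hp
  obtain ⟨r, c, hr, rfl⟩ := exists_eq_X_mul_add (one_ne_zero : (1 : Fin 2) ≠ 0) hq
  exact ⟨r, c, d, hr, by ring⟩

/-- If all products of `f` with forms of degree `a` lie in an ideal, so do the products with forms
of higher degree. -/
theorem mul_mem_of_le {J : Ideal (Pxy K)} {f : Pxy K} {a b : ℕ} (hab : a ≤ b)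
    (h : ∀ q : Pxy K, q.IsHomogeneous a → f * q ∈ J) {q : Pxy K} (hq : q.IsHomogeneous b) :
    f * q ∈ J := by
  induction b, hab using Nat.le_induction generalizing q with
  | base => exact h q hq
  | succ b hb ih =>
    obtain ⟨r, c, hr, rfl⟩ := exists_eq_X_mul_add (zero_ne_one : (0 : Fin 2) ≠ 1) hq
    have h1 := J.mul_mem_left (X 0) (ih hr)
    have h2 := J.mul_mem_left (C c * X 1) (ih (isHomogeneous_X_pow 1 b))
    convert J.add_mem h1 h2 using 1
    ring

/-- A space of polynomials whose dimension grows by at most one under multiplication by the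
variables contains all multiples, by forms of a fixed degree, of some polynomial. -/
theorem exists_mul_mem_of_finrank_le (d : ℕ) (V W : Submodule K (Pxy K)) [FiniteDimensional K V]
    [FiniteDimensional K W] (hX : ∀ i : Fin 2, ∀ v ∈ V, X i * v ∈ W)
    (hV : Module.finrank K V = d + 1) (hW : Module.finrank K W ≤ d + 2) :
    ∃ g : Pxy K, g ≠ 0 ∧ ∀ q : Pxy K, q.IsHomogeneous d → g * q ∈ V := by
  induction d generalizing V W with
  | zero =>
    obtain ⟨⟨g, hg⟩, hg0⟩ := Module.finrank_pos_iff_exists_ne_zero.1 (by omega :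
      0 < Module.finrank K V)
    refine ⟨g, by simpa using hg0, fun q hq => ?_⟩
    obtain ⟨c, rfl⟩ : ∃ c : K, q = C c := ⟨_, (totalDegree_eq_zero_iff_eq_C.1
      ((totalDegree_zero_iff_isHomogeneous _).2 hq))⟩
    rw [mul_comm, ← smul_eq_C_mul]
    exact V.smul_mem c hg
  | succ d ih =>
    set A := V.map (LinearMap.mulLeft K (X 0 : Pxy K)) with hA
    set B := V.map (LinearMap.mulLeft K (X 1 : Pxy K)) with hB
    set U : Submodule K (Pxy K) :=
      V.comap (LinearMap.mulLeft K (X 0 : Pxy K)) ⊓ V.comap (LinearMap.mulLeft K (X 1 : Pxy K))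
      with hU
    have hAB : A ⊔ B ≤ W := by
      refine sup_le ?_ ?_ <;> rintro _ ⟨v, hv, rfl⟩ <;> exact hX _ v hv
    have h1 := Submodule.finrank_sup_add_finrank_inf_eq A B
    have h2 := (Submodule.finrank_mono hAB).trans hW
    rw [hA, hB, finrank_map_mulLeft (X_ne_zero _), finrank_map_mulLeft (X_ne_zero _),
      ← hA, ← hB] at h1
    have hle : A ⊓ B ≤ U.map (LinearMap.mulLeft K (X 0 * X 1 : Pxy K)) := by
      rintro _ ⟨⟨v, hv, rfl⟩, w, hw, h⟩
      simp only [LinearMap.mulLeft_apply] at h ⊢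
      have hdvd : (X 1 : Pxy K) ∣ X 0 * v := ⟨w, h.symm⟩
      rcases (X_prime (R := K)).dvd_or_dvd hdvd with h' | ⟨u, rfl⟩
      · exact absurd (X_dvd_X.1 h') one_ne_zero
      · have hwu : w = X 0 * u := mul_left_cancel₀ (X_ne_zero (R := K) (1 : Fin 2)) (by
          rw [h]; ring)
        exact ⟨u, ⟨(hwu ▸ hw : X 0 * u ∈ V), hv⟩, by simp only [LinearMap.mulLeft_apply]; ring⟩
    have hUA : U.map (LinearMap.mulLeft K (X 0 : Pxy K)) ≤ V := by
      rintro _ ⟨u, hu, rfl⟩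
      exact hu.1
    have : FiniteDimensional K U := by
      have := Submodule.finiteDimensional_of_le hUA
      exact LinearEquiv.finiteDimensional (Submodule.equivMapOfInjective
        (LinearMap.mulLeft K (X 0 : Pxy K))
        (fun _ _ h => mul_left_cancel₀ (X_ne_zero _) h) U).symm
    have h3 := Submodule.finrank_mono hle
    rw [finrank_map_mulLeft (mul_ne_zero (X_ne_zero _) (X_ne_zero _))] at h3
    obtain ⟨b, hb⟩ := exists_linearIndependent_of_le_finrank
      (by omega : d + 1 ≤ Module.finrank K U)
    set U' : Submodule K (Pxy K) := (Submodule.span K (Set.range b)).map U.subtype with hU'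
    have hU'U : U' ≤ U := by
      rintro _ ⟨u, -, rfl⟩
      exact u.2
    have hfin : Module.finrank K U' = d + 1 := by
      rw [hU', Submodule.finrank_map_subtype_eq, finrank_span_eq_card hb, Fintype.card_fin]
    have : FiniteDimensional K U' := Submodule.finiteDimensional_of_le hU'U
    obtain ⟨g, hg0, hg⟩ := ih U' V (by
      intro i v hv
      fin_cases i
      exacts [(hU'U hv).1, (hU'U hv).2]) hfin hV.le
    refine ⟨g, hg0, fun q hq => ?_⟩
    obtain ⟨r, c, hr, rfl⟩ := exists_eq_X_mul_add (zero_ne_one : (0 : Fin 2) ≠ 1) hq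
    have h4 : X 0 * (g * r) ∈ V := (hU'U (hg r hr)).1
    have h5 : X 1 * (g * X 1 ^ d) ∈ V := (hU'U (hg _ (isHomogeneous_X_pow 1 d))).2
    convert V.add_mem h4 (V.smul_mem c h5) using 1
    rw [smul_eq_C_mul]
    ring

theorem exists_form_mul_mem {J : Ideal (Pxy K)} {a d : ℕ}
    (h1 : Module.finrank K (degreePart J (a + d)) = d + 1)
    (h2 : Module.finrank K (degreePart J (a + d + 1)) = d + 2) :
    ∃ g : Pxy K, g ≠ 0 ∧ g.IsHomogeneous a ∧ ∀ q : Pxy K, q.IsHomogeneous d → g * q ∈ J := by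
  obtain ⟨g, hg0, hg⟩ := exists_mul_mem_of_finrank_le d (degreePart J (a + d))
    (degreePart J (a + d + 1)) (fun i v hv => ⟨J.mul_mem_left _ hv.1,
      add_comm 1 (a + d) ▸ (isHomogeneous_X K i).mul hv.2⟩) h1 h2.le
  refine ⟨g, hg0, ?_, fun q hq => (hg q hq).1⟩
  have h := (hg _ (isHomogeneous_X_pow 0 d)).2
  rw [mul_comm, add_comm] at h
  exact isHomogeneous_of_mul_left (isHomogeneous_X_pow 0 d) (pow_ne_zero _ (X_ne_zero _)) h

theorem degreePart_eq_mulForms {J : Ideal (Pxy K)} {f : Pxy K} {a b j : ℕ} (hf0 : f ≠ 0)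
    (hf : f.IsHomogeneous b) (h : ∀ q : Pxy K, q.IsHomogeneous a → f * q ∈ J)
    (hj : a ≤ j) (hd : Module.finrank K (degreePart J (b + j)) ≤ j + 1) :
    mulForms f j = degreePart J (b + j) := by
  refine Submodule.eq_of_le_of_finrank_le ?_ (by rwa [finrank_mulForms hf0])
  rintro _ ⟨q, hq, rfl⟩
  exact ⟨mul_mem_of_le hj h hq, hf.mul hq⟩

theorem IsLinChange.isHomogeneous {φ : Pxy K ≃ₐ[K] Pxy K} (hφ : IsLinChange φ) {p : Pxy K} {j : ℕ}
    (hp : p.IsHomogeneous j) : (φ p).IsHomogeneous j := by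
  have h := hp.aeval (fun i => φ (X i)) hφ
  rw [one_mul] at h
  convert h using 1
  exact DFunLike.congr_fun (aeval_unique φ.toAlgHom) p

theorem IsLinChange.map_homogeneousSubmodule {φ : Pxy K ≃ₐ[K] Pxy K} (hφ : IsLinChange φ) (j : ℕ) :
    (homogeneousSubmodule (Fin 2) K j).map φ.toLinearMap = homogeneousSubmodule (Fin 2) K j := by
  refine Submodule.eq_of_le_of_finrank_eq ?_ (φ.toLinearEquiv.finrank_map_eq _)
  rintro _ ⟨p, hp, rfl⟩
  exact hφ.isHomogeneous hp

theorem IsLinChange.isHomogeneous_iff {φ : Pxy K ≃ₐ[K] Pxy K} (hφ : IsLinChange φ) {p : Pxy K}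
    {j : ℕ} : (φ p).IsHomogeneous j ↔ p.IsHomogeneous j := by
  refine ⟨fun h => ?_, hφ.isHomogeneous⟩
  rw [← mem_homogeneousSubmodule, ← hφ.map_homogeneousSubmodule] at h
  obtain ⟨q, hq, h⟩ := h
  rwa [φ.injective h] at hq

theorem IsLinChange.symm {φ : Pxy K ≃ₐ[K] Pxy K} (hφ : IsLinChange φ) : IsLinChange φ.symm :=
  fun i => hφ.isHomogeneous_iff.1 (by simpa using isHomogeneous_X K i)

theorem IsLinChange.trans {φ ψ : Pxy K ≃ₐ[K] Pxy K} (hφ : IsLinChange φ) (hψ : IsLinChange ψ) :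
    IsLinChange (φ.trans ψ) :=
  fun i => hψ.isHomogeneous (hφ i)

theorem IsLinChange.homogeneousComponent {φ : Pxy K ≃ₐ[K] Pxy K} (hφ : IsLinChange φ) (j : ℕ)
    (p : Pxy K) : homogeneousComponent j (φ p) = φ (homogeneousComponent j p) := by
  conv_lhs => rw [← sum_homogeneousComponent p, map_sum, map_sum]
  have h (i : ℕ) : MvPolynomial.homogeneousComponent j (φ (MvPolynomial.homogeneousComponent i p)) =
      if j = i then φ (MvPolynomial.homogeneousComponent i p) else 0 :=
    homogeneousComponent_of_mem (hφ.isHomogeneous (homogeneousComponent_isHomogeneous i p))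
  simp only [h, Finset.sum_ite_eq, Finset.mem_range]
  split_ifs with hj
  · rfl
  · rw [homogeneousComponent_eq_zero _ _ (by omega), map_zero]

theorem mem_map_algEquiv {φ : Pxy K ≃ₐ[K] Pxy K} {J : Ideal (Pxy K)} {p : Pxy K} :
    p ∈ J.map φ ↔ ∃ q ∈ J, φ q = p :=
  Ideal.mem_map_iff_of_surjective φ φ.surjective

theorem IsLinChange.isHomog_map {φ : Pxy K ≃ₐ[K] Pxy K} (hφ : IsLinChange φ) {J : Ideal (Pxy K)}
    (hJ : IsHomog J) : IsHomog (J.map φ) := by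
  intro p hp j
  obtain ⟨q, hq, rfl⟩ := mem_map_algEquiv.1 hp
  rw [hφ.homogeneousComponent]
  exact Ideal.mem_map_of_mem φ (hJ q hq j)

theorem IsLinChange.hilb_map {φ : Pxy K ≃ₐ[K] Pxy K} (hφ : IsLinChange φ) (J : Ideal (Pxy K))
    (j : ℕ) : hilb K (J.map φ) j = hilb K J j := by
  have h : degreePart (J.map φ) j = (degreePart J j).map φ.toLinearEquiv.toLinearMap := by
    ext p
    constructor
    · rintro ⟨hp, hpj⟩
      obtain ⟨q, hq, rfl⟩ := mem_map_algEquiv.1 hp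
      exact ⟨q, ⟨hq, hφ.isHomogeneous_iff.1 hpj⟩, rfl⟩
    · rintro ⟨q, ⟨hq, hqj⟩, rfl⟩
      exact ⟨Ideal.mem_map_of_mem φ hq, hφ.isHomogeneous hqj⟩
  have h1 := hilb_add_finrank_degreePart (J.map φ) j
  have h2 := hilb_add_finrank_degreePart J j
  rw [h, φ.toLinearEquiv.finrank_map_eq] at h1
  omega

theorem exists_isLinChange {a b c d : K} (h : a * d - b * c ≠ 0) :
    ∃ φ : Pxy K ≃ₐ[K] Pxy K, IsLinChange φ ∧ φ (X 0) = C a * X 0 + C b * X 1 ∧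
      φ (X 1) = C c * X 0 + C d * X 1 := by
  obtain ⟨e, he⟩ : ∃ e : K, e * (a * d - b * c) = 1 := ⟨_, inv_mul_cancel₀ h⟩
  have hE : (C e * (C a * C d - C b * C c) : Pxy K) = 1 := by
    rw [← C_mul, ← C_mul, ← C_sub, ← C_mul, he, C_1]
  let φ : Pxy K ≃ₐ[K] Pxy K := AlgEquiv.ofAlgHom
    (aeval ![C a * X 0 + C b * X 1, C c * X 0 + C d * X 1])
    (aeval ![C e * (C d * X 0 - C b * X 1), C e * (C a * X 1 - C c * X 0)])
    (by
      refine algHom_ext fun i => ?_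
      fin_cases i <;> simp [algebraMap_eq]
      · linear_combination X 0 * hE
      · linear_combination X 1 * hE)
    (by
      refine algHom_ext fun i => ?_
      fin_cases i <;> simp [algebraMap_eq]
      · linear_combination X 0 * hE
      · linear_combination X 1 * hE)
  have h0 : φ (X 0) = C a * X 0 + C b * X 1 := by simp [φ]
  have h1 : φ (X 1) = C c * X 0 + C d * X 1 := by simp [φ]
  refine ⟨φ, fun i => ?_, h0, h1⟩
  fin_cases i
  · exact h0 ▸ (isHomogeneous_C_mul_X a 0).add (isHomogeneous_C_mul_X b 1)
  · exact h1 ▸ (isHomogeneous_C_mul_X c 0).add (isHomogeneous_C_mul_X d 1)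

theorem algEquiv_C (φ : Pxy K ≃ₐ[K] Pxy K) (c : K) : φ (C c) = C c := φ.commutes c

theorem exists_eq_mul_of_isHomogeneous_two [IsAlgClosed K] [CharZero K] {g : Pxy K}
    (hg : g.IsHomogeneous 2) : ∃ a b c d : K,
      g = (C a * X 0 + C b * X 1) * (C c * X 0 + C d * X 1) := by
  obtain ⟨q, β, γ, hq, rfl⟩ := exists_eq_X_zero_sq_mul_add (m := 0) hg
  obtain ⟨α, rfl⟩ : ∃ c : K, q = C c := ⟨_, (totalDegree_eq_zero_iff_eq_C.1
    ((totalDegree_zero_iff_isHomogeneous _).2 hq))⟩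
  by_cases hα : α = 0
  · refine ⟨0, 1, β, γ, ?_⟩
    simp only [hα, C_0, C_1]
    ring
  · obtain ⟨s, hs⟩ := IsAlgClosed.exists_pow_nat_eq (discrim α β γ) two_pos
    obtain ⟨r, hr⟩ := exists_quadratic_eq_zero hα ⟨s, by rw [← hs, sq]⟩
    have hr' : (C α * (C r * C r) + C β * C r + C γ : Pxy K) = 0 := by
      rw [← C_mul, ← C_mul, ← C_mul, ← C_add, ← C_add, hr, C_0]
    refine ⟨1, -r, α, β + α * r, ?_⟩
    simp only [C_1, C_neg, C_add, C_mul]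
    linear_combination X 1 ^ 2 * hr'

theorem exists_isLinChange_sq {a b s : K} (h : a ≠ 0 ∨ b ≠ 0) :
    ∃ φ : Pxy K ≃ₐ[K] Pxy K, IsLinChange φ ∧
      φ (C s * (C a * X 0 + C b * X 1) ^ 2) = C s * X 0 ^ 2 := by
  obtain ⟨c, d, hcd⟩ : ∃ c d : K, a * d - b * c ≠ 0 := by
    rcases h with h | h
    · exact ⟨0, 1, by simpa using h⟩
    · exact ⟨1, 0, by simpa using h⟩
  obtain ⟨φ, hφ, h0, -⟩ := exists_isLinChange hcd
  exact ⟨φ.symm, hφ.symm, by simp [← h0, algEquiv_C]⟩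

/-- A nonzero binary quadratic form is, up to a linear change of variables and scaling, either
`xy` or `x²`. -/
theorem exists_isLinChange_quadratic [IsAlgClosed K] [CharZero K] {g : Pxy K}
    (hg : g.IsHomogeneous 2) (hg0 : g ≠ 0) : ∃ (φ : Pxy K ≃ₐ[K] Pxy K) (s : K),
      IsLinChange φ ∧ s ≠ 0 ∧ (φ g = C s * (X 0 * X 1) ∨ φ g = C s * X 0 ^ 2) := by
  obtain ⟨a, b, c, d, rfl⟩ := exists_eq_mul_of_isHomogeneous_two hg
  by_cases hΔ : a * d - b * c = 0
  · have hab : a ≠ 0 ∨ b ≠ 0 := by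
      by_contra! h
      simp [h.1, h.2] at hg0
    obtain ⟨s, rfl, rfl⟩ : ∃ s : K, c = s * a ∧ d = s * b := by
      rcases hab with h | h
      · exact ⟨c / a, by field_simp, by field_simp; linear_combination hΔ⟩
      · exact ⟨d / b, by field_simp; linear_combination -hΔ, by field_simp⟩
    have he : ((C a * X 0 + C b * X 1) * (C (s * a) * X 0 + C (s * b) * X 1) : Pxy K) =
        C s * (C a * X 0 + C b * X 1) ^ 2 := by
      simp only [C_mul]
      ring
    rw [he] at hg0 ⊢
    obtain ⟨φ, hφ, h⟩ := exists_isLinChange_sq (s := s) hab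
    exact ⟨φ, s, hφ, by rintro rfl; simp at hg0, Or.inr h⟩
  · obtain ⟨φ, hφ, h0, h1⟩ := exists_isLinChange hΔ
    exact ⟨φ.symm, 1, hφ.symm, one_ne_zero, Or.inl (by simp [← h0, ← h1])⟩

/-- The ideal `J` is homogeneous with Hilbert function `t`, contains all products of `f` with forms
of degree `m`, and contains the form `h` of degree `N`, which is not a multiple of `f`. -/
structure HasForms (t : ℕ → ℕ) (m N : ℕ) (J : Ideal (Pxy K)) (f h : Pxy K) : Prop where
  isHomog : IsHomog J
  hilb_eq : ∀ j, hilb K J j = t j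
  mul_mem : ∀ q : Pxy K, q.IsHomogeneous m → f * q ∈ J
  mem : h ∈ J
  isHomogeneous : h.IsHomogeneous N
  not_dvd : ¬ f ∣ h

namespace HasForms

variable {t : ℕ → ℕ} {m M N : ℕ} {J : Ideal (Pxy K)} {f h : Pxy K}

theorem map (H : HasForms t m N J f h) {φ : Pxy K ≃ₐ[K] Pxy K} (hφ : IsLinChange φ) :
    HasForms t m N (J.map φ) (φ f) (φ h) where
  isHomog := hφ.isHomog_map H.isHomog
  hilb_eq j := (hφ.hilb_map J j).trans (H.hilb_eq j)
  mul_mem q hq := by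
    have := Ideal.mem_map_of_mem φ (H.mul_mem _ (hφ.symm.isHomogeneous hq))
    simpa using this
  mem := Ideal.mem_map_of_mem φ H.mem
  isHomogeneous := hφ.isHomogeneous H.isHomogeneous
  not_dvd hd := H.not_dvd ((map_dvd_iff φ).1 hd)

theorem of_C_mul {s : K} (hs : s ≠ 0) (H : HasForms t m N J (C s * f) h) :
    HasForms t m N J f h := by
  have he : (C s⁻¹ * C s : Pxy K) = 1 := by rw [← C_mul, inv_mul_cancel₀ hs, C_1]
  refine ⟨H.isHomog, H.hilb_eq, fun q hq => ?_, H.mem, H.isHomogeneous, ?_⟩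
  · convert J.mul_mem_left (C s⁻¹) (H.mul_mem q hq) using 1
    linear_combination -(f * q) * he
  · rintro ⟨r, rfl⟩
    exact H.not_dvd ⟨C s⁻¹ * r, by linear_combination -(f * r) * he⟩

theorem of_dvd_sub (H : HasForms t m (M + 2) J f h) (hm : m ≤ M) (hf : f.IsHomogeneous 2)
    (hf0 : f ≠ 0) {h' : Pxy K} (hh' : h'.IsHomogeneous (M + 2)) {c : K}
    (hd : f ∣ h - C c * h') : HasForms t m (M + 2) J f h' := by
  have hc : c ≠ 0 := by
    rintro rfl
    exact H.not_dvd (by simpa using hd)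
  have he : (C c⁻¹ * C c : Pxy K) = 1 := by rw [← C_mul, inv_mul_cancel₀ hc, C_1]
  refine ⟨H.isHomog, H.hilb_eq, H.mul_mem, ?_, hh', fun hd' => H.not_dvd ?_⟩
  · obtain ⟨r, hr⟩ := hd
    have hrM : r.IsHomogeneous M := by
      refine isHomogeneous_of_mul_left hf hf0 ?_
      rw [← hr, add_comm 2 M]
      exact H.isHomogeneous.sub (hh'.C_mul c)
    have h1 := J.sub_mem H.mem (mul_mem_of_le hm H.mul_mem hrM)
    convert J.mul_mem_left (C c⁻¹) h1 using 1
    rw [← hr]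
    linear_combination -h' * he
  · exact (dvd_sub_left (hd'.mul_left _)).1 hd

end HasForms

/-- One of the four normal forms of ideals with forms `f` and `h`. -/
def IsNormal (t : ℕ → ℕ) (m M : ℕ) (J : Ideal (Pxy K)) : Prop :=
  HasForms t m (M + 2) J (X 0 * X 1) (X 0 ^ (M + 2)) ∨
  HasForms t m (M + 2) J (X 0 * X 1) (X 0 ^ (M + 2) + X 1 ^ (M + 2)) ∨
  HasForms t m (M + 2) J (X 0 ^ 2) (X 0 * X 1 ^ (M + 1)) ∨
  HasForms t m (M + 2) J (X 0 ^ 2) (X 1 ^ (M + 2))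

/-- Some linear change of variables maps `J` to an ideal in normal form. -/
def IsNormalizable (t : ℕ → ℕ) (m M : ℕ) (J : Ideal (Pxy K)) : Prop :=
  ∃ φ : Pxy K ≃ₐ[K] Pxy K, IsLinChange φ ∧ IsNormal t m M (J.map φ)

theorem IsNormal.isNormalizable {t : ℕ → ℕ} {m M : ℕ} {J : Ideal (Pxy K)}
    (h : IsNormal t m M J) : IsNormalizable t m M J :=
  ⟨AlgEquiv.refl, isHomogeneous_X K, by
    rwa [show J.map (AlgEquiv.refl : Pxy K ≃ₐ[K] Pxy K) = J from Ideal.map_id J]⟩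

theorem IsNormalizable.of_map {t : ℕ → ℕ} {m M : ℕ} {J : Ideal (Pxy K)} {φ : Pxy K ≃ₐ[K] Pxy K}
    (hφ : IsLinChange φ) (h : IsNormalizable t m M (J.map φ)) : IsNormalizable t m M J := by
  obtain ⟨ψ, hψ, h⟩ := h
  refine ⟨φ.trans ψ, hφ.trans hψ, ?_⟩
  rwa [show J.map (φ.trans ψ) = (J.map φ).map ψ from
    (Ideal.map_map (φ : Pxy K →+* Pxy K) (ψ : Pxy K →+* Pxy K)).symm]

namespace HasForms

variable {t : ℕ → ℕ} {m M : ℕ} {J : Ideal (Pxy K)} {h : Pxy K}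

theorem isHomogeneous_X_mul_X : (X 0 * X 1 : Pxy K).IsHomogeneous 2 :=
  (isHomogeneous_X K 0).mul (isHomogeneous_X K 1)

theorem X_mul_X_ne_zero : (X 0 * X 1 : Pxy K) ≠ 0 := mul_ne_zero (X_ne_zero _) (X_ne_zero _)

theorem isNormalizable_of_mul [IsAlgClosed K] (hm : m ≤ M)
    (H : HasForms t m (M + 2) J (X 0 * X 1) h) : IsNormalizable t m M J := by
  obtain ⟨q, c, d, -, rfl⟩ := exists_eq_X_zero_mul_X_one_mul_add H.isHomogeneous
  by_cases hd : d = 0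
  · exact IsNormal.isNormalizable (Or.inl (H.of_dvd_sub hm isHomogeneous_X_mul_X X_mul_X_ne_zero
      (isHomogeneous_X_pow 0 _) (c := c) ⟨q, by simp [hd]⟩))
  by_cases hc : c = 0
  · have H1 := H.of_dvd_sub hm isHomogeneous_X_mul_X X_mul_X_ne_zero
      (isHomogeneous_X_pow 1 _) (c := d) ⟨q, by simp [hc]⟩
    obtain ⟨φ, hφ, h0, h1⟩ := exists_isLinChange (K := K) (a := 0) (b := 1) (c := 1) (d := 0)
      (by simp)
    have H2 := H1.map hφ
    simp only [map_mul, map_pow, h0, h1, C_0, C_1, zero_mul, one_mul, zero_add, add_zero] at H2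
    rw [mul_comm] at H2
    exact .of_map hφ (IsNormal.isNormalizable (Or.inl H2))
  · obtain ⟨u, hu⟩ := IsAlgClosed.exists_pow_nat_eq (d / c) (by omega : 0 < M + 2)
    have hu0 : u ≠ 0 := by
      rintro rfl
      rw [zero_pow (by omega)] at hu
      exact div_ne_zero hd hc hu.symm
    obtain ⟨φ, hφ, h0, h1⟩ := exists_isLinChange (K := K) (a := u) (b := 0) (c := 0) (d := 1)
      (by simpa)
    have H2 := H.map hφ
    simp only [map_mul, map_pow, map_add, algEquiv_C, h0, h1, C_0, C_1, zero_mul, one_mul,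
      zero_add, add_zero] at H2
    rw [mul_assoc] at H2
    have hcu : (C c * C u ^ (M + 2) : Pxy K) = C d := by
      rw [← C_pow, ← C_mul, hu, mul_div_cancel₀ _ hc]
    refine .of_map hφ (IsNormal.isNormalizable (Or.inr (Or.inl ((H2.of_C_mul hu0).of_dvd_sub hm
      isHomogeneous_X_mul_X X_mul_X_ne_zero
      ((isHomogeneous_X_pow 0 _).add (isHomogeneous_X_pow 1 _)) (c := d) ⟨C u * φ q, ?_⟩))))
    linear_combination X 0 ^ (M + 2) * hcu

theorem isNormalizable_of_sq [CharZero K] (hm : m ≤ M)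
    (H : HasForms t m (M + 2) J (X 0 ^ 2) h) : IsNormalizable t m M J := by
  obtain ⟨q, c, d, -, rfl⟩ := exists_eq_X_zero_sq_mul_add H.isHomogeneous
  have hX : (X 0 ^ 2 : Pxy K) ≠ 0 := pow_ne_zero _ (X_ne_zero _)
  by_cases hd : d = 0
  · refine IsNormal.isNormalizable (Or.inr (Or.inr (Or.inl (H.of_dvd_sub hm
      (isHomogeneous_X_pow 0 2) hX ?_ (c := c) ⟨q, by simp [hd]⟩))))
    convert (isHomogeneous_X K (0 : Fin 2)).mul (isHomogeneous_X_pow 1 (M + 1)) using 1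
    omega
  · set N : K := ((M + 2 : ℕ) : K) with hN
    have hN0 : N ≠ 0 := Nat.cast_ne_zero.2 (by omega)
    obtain ⟨r, hr⟩ : ∃ r : K, c + d * (N * r) = 0 := ⟨-c / (d * N), by field_simp; ring⟩
    have hr' : (C c + C d * (((M + 2 : ℕ) : Pxy K) * C r) : Pxy K) = 0 := by
      rw [← map_natCast (C : K →+* Pxy K), ← C_mul, ← C_mul, ← C_add, hr, C_0]
    obtain ⟨φ, hφ, h0, h1⟩ := exists_isLinChange (K := K) (a := 1) (b := 0) (c := r) (d := 1)
      (by simp)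
    have H2 := H.map hφ
    simp only [map_mul, map_pow, map_add, algEquiv_C, h0, h1, C_0, C_1, zero_mul, one_mul,
      add_zero] at H2
    refine .of_map hφ (IsNormal.isNormalizable (Or.inr (Or.inr (Or.inr (H2.of_dvd_sub hm
      (isHomogeneous_X_pow 0 2) hX (isHomogeneous_X_pow 1 _) (c := d) ?_)))))
    obtain ⟨v, hv⟩ := Polynomial.powAddExpansion (X 1 : Pxy K) (C r * X 0) (M + 2)
    obtain ⟨w, hw⟩ := sub_dvd_pow_sub_pow (C r * X 0 + X 1 : Pxy K) (X 1) (M + 1)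
    rw [add_comm (X 1)] at hv
    rw [Nat.add_sub_assoc one_le_two] at hv
    refine ⟨φ q + C c * C r * w + C d * v * C r ^ 2, ?_⟩
    linear_combination C c * X 0 * hw + C d * hv + X 0 * X 1 ^ (M + 1) * hr'

theorem isNormalizable [IsAlgClosed K] [CharZero K] (hm : m ≤ M) {f : Pxy K}
    (hf : f.IsHomogeneous 2) (hf0 : f ≠ 0) (H : HasForms t m (M + 2) J f h) :
    IsNormalizable t m M J := by
  obtain ⟨φ, s, hφ, hs, h1 | h1⟩ := exists_isLinChange_quadratic hf hf0
  all_goals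
    refine .of_map hφ ?_
    have H1 := H.map hφ
    rw [h1] at H1
  · exact (H1.of_C_mul hs).isNormalizable_of_mul hm
  · exact (H1.of_C_mul hs).isNormalizable_of_sq hm

theorem le {n k l : ℕ} (hn : 2 ≤ n) (hk : 1 ≤ k) {f : Pxy K} (hf : f.IsHomogeneous 2)
    (hf0 : f ≠ 0) (ht : ∀ j, t j = if j < n then j + 1 else if j ≤ n + k then 2
        else if j ≤ n + k + 1 + l then 1 else 0) {J' : Ideal (Pxy K)}
    (H : HasForms t (n - 2) (n + k + 1) J f h) (H' : HasForms t (n - 2) (n + k + 1) J' f h) :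
    J ≤ J' := by
  have hJ (j : ℕ) : t j + Module.finrank K (degreePart J j) = j + 1 :=
    H.hilb_eq j ▸ hilb_add_finrank_degreePart J j
  have hJ' (j : ℕ) : t j + Module.finrank K (degreePart J' j) = j + 1 :=
    H'.hilb_eq j ▸ hilb_add_finrank_degreePart J' j
  have hN : degreePart J (n + k + 1) ≤ degreePart J' (n + k + 1) := by
    intro p hp
    have hd := hJ (n + k + 1)
    rw [ht, if_neg (by omega), if_neg (by omega), if_pos (by omega)] at hd
    have hle : mulForms f (n + k - 1) ≤ degreePart J (n + k + 1) := by
      rintro _ ⟨q, hq, rfl⟩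
      refine ⟨mul_mem_of_le (by omega) H.mul_mem hq, ?_⟩
      have := hf.mul hq
      rwa [show 2 + (n + k - 1) = n + k + 1 by omega] at this
    obtain ⟨c, q, hq, hc⟩ := exists_sub_smul_mem hle (by rw [finrank_mulForms hf0]; omega)
      ⟨H.mem, H.isHomogeneous⟩ (fun ⟨q, _, hq⟩ => H.not_dvd ⟨q, hq.symm⟩) hp
    refine ⟨?_, hp.2⟩
    rw [LinearMap.mulLeft_apply, smul_eq_C_mul] at hc
    have h1 := J'.add_mem (mul_mem_of_le (by omega : n - 2 ≤ n + k - 1) H'.mul_mem hq)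
      (J'.mul_mem_left (C c) H'.mem)
    rwa [hc, sub_add_cancel] at h1
  have key (j : ℕ) : degreePart J j ≤ degreePart J' j := by
    have hd := hJ j
    have hd' := hJ' j
    rw [ht] at hd hd'
    rcases lt_or_ge j n with h1 | h1
    · rw [if_pos h1] at hd
      rw [Submodule.finrank_eq_zero.1 (by omega : Module.finrank K (degreePart J j) = 0)]
      exact bot_le
    rw [if_neg (by omega)] at hd hd'
    rcases le_or_gt j (n + k) with h2 | h2
    · rw [if_pos h2] at hd hd'
      obtain ⟨i, rfl⟩ := Nat.exists_eq_add_of_le (by omega : 2 ≤ j)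
      rw [← degreePart_eq_mulForms hf0 hf H.mul_mem (by omega) (by omega),
        ← degreePart_eq_mulForms hf0 hf H'.mul_mem (by omega) (by omega)]
    rw [if_neg (by omega)] at hd hd'
    rcases le_or_gt j (n + k + 1 + l) with h3 | h3
    · rw [if_pos h3] at hd hd'
      rcases (show n + k + 1 ≤ j from h2).eq_or_lt with rfl | h4
      · exact hN
      have d1 := hJ (1 + (n + k))
      have d2 := hJ (1 + (n + k) + 1)
      rw [ht, if_neg (by omega), if_neg (by omega), if_pos (by omega)] at d1 d2
      obtain ⟨g, hg0, hg, hgJ⟩ := exists_form_mul_mem (J := J) (a := 1) (d := n + k)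
        (by omega) (by omega)
      have hgJ' (q : Pxy K) (hq : q.IsHomogeneous (n + k)) : g * q ∈ J' :=
        (hN ⟨hgJ q hq, add_comm 1 (n + k) ▸ hg.mul hq⟩).1
      obtain ⟨i, rfl⟩ := Nat.exists_eq_add_of_le (by omega : 1 ≤ j)
      rw [← degreePart_eq_mulForms hg0 hg hgJ (by omega) (by omega),
        ← degreePart_eq_mulForms hg0 hg hgJ' (by omega) (by omega)]
    · rw [if_neg (by omega)] at hd'
      refine inf_le_right.trans (Submodule.eq_of_le_of_finrank_eq (inf_le_right :
        degreePart J' j ≤ homogeneousSubmodule (Fin 2) K j) ?_).ge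
      rw [finrank_homogeneousSubmodule]
      change Module.finrank K (degreePart J' j) = j + 1
      omega
  intro p hp
  rw [← sum_homogeneousComponent p]
  exact J'.sum_mem fun j _ =>
    (key j ⟨H.isHomog p hp j, homogeneousComponent_isHomogeneous j p⟩).1

theorem subsingleton {n k l : ℕ} (hn : 2 ≤ n) (hk : 1 ≤ k) {f : Pxy K} (hf : f.IsHomogeneous 2)
    (hf0 : f ≠ 0) (ht : ∀ j, t j = if j < n then j + 1 else if j ≤ n + k then 2
        else if j ≤ n + k + 1 + l then 1 else 0) (h : Pxy K) :
    {J | HasForms t (n - 2) (n + k + 1) J f h}.Subsingleton :=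
  fun _ H _ H' => le_antisymm (H.le hn hk hf hf0 ht H') (H'.le hn hk hf hf0 ht H)

end HasForms

theorem exists_hasForms {n k l : ℕ} (hn : 2 ≤ n) (hk : 1 ≤ k) {t : ℕ → ℕ}
    (ht : ∀ j, t j = if j < n then j + 1 else if j ≤ n + k then 2
      else if j ≤ n + k + 1 + l then 1 else 0) {J : Ideal (Pxy K)} (hJ : IsHomog J)
    (hJt : ∀ j, hilb K J j = t j) : ∃ f h : Pxy K, f.IsHomogeneous 2 ∧ f ≠ 0 ∧
      HasForms t (n - 2) (n + k + 1) J f h := by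
  have hd (j : ℕ) : t j + Module.finrank K (degreePart J j) = j + 1 :=
    hJt j ▸ hilb_add_finrank_degreePart J j
  have d1 := hd (2 + (n - 2))
  have d2 := hd (2 + (n - 2) + 1)
  rw [ht, if_neg (by omega), if_pos (by omega)] at d1 d2
  obtain ⟨f, hf0, hf, hfJ⟩ := exists_form_mul_mem (J := J) (a := 2) (d := n - 2)
    (by omega) (by omega)
  have d3 := hd (n + k + 1)
  rw [ht, if_neg (by omega), if_neg (by omega), if_pos (by omega)] at d3
  obtain ⟨h, hh, hh'⟩ : ∃ h ∈ degreePart J (n + k + 1), h ∉ mulForms f (n + k - 1) := by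
    by_contra! hle
    have := Submodule.finrank_mono (show degreePart J (n + k + 1) ≤ _ from hle)
    rw [finrank_mulForms hf0] at this
    omega
  refine ⟨f, h, hf, hf0, hJ, hJt, hfJ, hh.1, hh.2, ?_⟩
  rintro ⟨q, rfl⟩
  refine hh' (mul_mem_mulForms f (isHomogeneous_of_mul_left hf hf0 ?_))
  rw [show 2 + (n + k - 1) = n + k + 1 by omega]
  exact hh.2

end

/-- The sequence `T₇ = (1, 2, …, n, 2, …, 2, 1, …, 1)` is of homogeneous finite
type. -/
theorem stmt15 (K : Type*) [Field K] [IsAlgClosed K] [CharZero K]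
    (n k l : ℕ) (hn : 2 ≤ n) (hk : 1 ≤ k) :
    HomogFiniteType K
      (fun j => if j < n then j + 1 else if j ≤ n + k then 2
        else if j ≤ n + k + 1 + l then 1 else 0) := by
  set t : ℕ → ℕ := fun j => if j < n then j + 1 else if j ≤ n + k then 2
    else if j ≤ n + k + 1 + l then 1 else 0 with ht
  have ht' (j : ℕ) : t j = if j < n then j + 1 else if j ≤ n + k then 2
    else if j ≤ n + k + 1 + l then 1 else 0 := rfl
  have hM : n + k - 1 + 2 = n + k + 1 := by omega
  refine ⟨{J | IsNormal t (n - 2) (n + k - 1) J}, ?_, ?_, fun I hI hIt => ?_⟩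
  · have h1 (h : Pxy K) := (HasForms.subsingleton hn hk HasForms.isHomogeneous_X_mul_X
      HasForms.X_mul_X_ne_zero ht' h).finite
    have h2 (h : Pxy K) := (HasForms.subsingleton hn hk (isHomogeneous_X_pow 0 2)
      (pow_ne_zero 2 (X_ne_zero 0)) ht' h).finite
    simp only [IsNormal, hM, Set.ofPred_or]
    exact (h1 _).union ((h1 _).union ((h2 _).union (h2 _)))
  · rintro J (H | H | H | H) <;> exact H.isHomog
  · obtain ⟨f, h, hf, hf0, H⟩ := exists_hasForms hn hk ht' hI hIt
    rw [← hM] at H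
    exact H.isNormalizable (by omega) hf hf0
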